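/- There exists a constant c ≥ 1 such that for every m ≥ 0 one has 𝓡̄_m ≤ 𝓡_m ≤ c·𝓡̄_m; that is, the point-to-point resistance 𝓡_m and the side-to-side resistance 𝓡̄_m are comparable with a constant independent of m. (Proposition 3.8 of the paper in the planar case, together with the a priori inequality 𝓡̄_m ≤ 𝓡_m.) -/

import Mathlib

open Finset
open scoped Classical

namespace Carpet

/-- The contraction map `Ψ_{(a,b)}(x,y) = ((x+a)/L, (y+b)/L)`. -/
noncomputable def Psi (L : ℕ) (p : ℕ × ℕ) (x : ℝ × ℝ) : ℝ × ℝ :=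
  ((x.1 + p.1) / L, (x.2 + p.2) / L)

/-- Words of length `n` over the alphabet `A`. -/
abbrev Word (A : Finset (ℕ × ℕ)) (n : ℕ) := Fin n → {p : ℕ × ℕ // p ∈ A}

/-- `Ψ_w = Ψ_{w₁} ∘ ⋯ ∘ Ψ_{w_n}`. -/
noncomputable def PsiW (L : ℕ) {A : Finset (ℕ × ℕ)} {n : ℕ} (w : Word A n) : ℝ × ℝ → ℝ × ℝ :=
  (List.ofFn fun i => Psi L (w i).1).foldr (· ∘ ·) id

/-- The four corners of the unit square. -/
noncomputable def V0 : Finset (ℝ × ℝ) :=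
  {((0 : ℝ), (0 : ℝ)), ((1 : ℝ), (0 : ℝ)), ((1 : ℝ), (1 : ℝ)), ((0 : ℝ), (1 : ℝ))}

/-- The level-`n` vertex set `V_n = ⋃_{w ∈ W_n} Ψ_w(V₀)`. -/
noncomputable def VN (L : ℕ) (A : Finset (ℕ × ℕ)) (n : ℕ) : Finset (ℝ × ℝ) :=
  (Finset.univ : Finset (Word A n)).biUnion fun w => V0.image (PsiW L w)

/-- Euclidean distance in the plane. -/
noncomputable def eudist (x y : ℝ × ℝ) : ℝ :=
  Real.sqrt ((x.1 - y.1) ^ 2 + (x.2 - y.2) ^ 2)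

/-- `n`-adjacency: `x = Ψ_w(p)`, `y = Ψ_w(q)` with `p, q ∈ V₀`, `|p - q| = 1`. -/
def Adj (L : ℕ) (A : Finset (ℕ × ℕ)) (n : ℕ) (x y : ℝ × ℝ) : Prop :=
  ∃ w : Word A n, ∃ p ∈ V0, ∃ q ∈ V0,
    eudist p q = 1 ∧ x = PsiW L w p ∧ y = PsiW L w q

/-- The natural graph energy `D_n(f) = Σ_{x ∼ y} (f x - f y)²`
(summing over ordered pairs and halving). -/
noncomputable def Dform (L : ℕ) (A : Finset (ℕ × ℕ)) (n : ℕ) (f : ℝ × ℝ → ℝ) : ℝ :=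
  (1 / 2) * ∑ x ∈ VN L A n, ∑ y ∈ VN L A n,
    (if Adj L A n x y then (f x - f y) ^ 2 else 0)

/-- The effective resistance between `S` and `T` in the level-`n` graph. -/
noncomputable def EffRes (L : ℕ) (A : Finset (ℕ × ℕ)) (n : ℕ) (S T : Set (ℝ × ℝ)) : ℝ :=
  (sInf {e : ℝ | ∃ f : ℝ × ℝ → ℝ,
      (∀ x ∈ S, f x = 1) ∧ (∀ x ∈ T, f x = 0) ∧ e = Dform L A n f})⁻¹

/-- `𝓡_n`, the resistance between the corners `(0,0)` and `(1,0)`. -/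
noncomputable def RR (L : ℕ) (A : Finset (ℕ × ℕ)) (n : ℕ) : ℝ :=
  EffRes L A n {((0 : ℝ), (0 : ℝ))} {((1 : ℝ), (0 : ℝ))}

/-- `𝓡̄_n`, the resistance between the left and right sides of the unit square. -/
noncomputable def RRbar (L : ℕ) (A : Finset (ℕ × ℕ)) (n : ℕ) : ℝ :=
  EffRes L A n
    ((VN L A n : Set (ℝ × ℝ)) ∩ ({(0 : ℝ)} ×ˢ Set.Icc (0 : ℝ) 1))
    ((VN L A n : Set (ℝ × ℝ)) ∩ ({(1 : ℝ)} ×ˢ Set.Icc (0 : ℝ) 1))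

/-- The standing assumptions on `(L, A)` defining a generalized Sierpiński carpet. -/
structure GoodCarpet (L : ℕ) (A : Finset (ℕ × ℕ)) : Prop where
  three_le : 3 ≤ L
  mem_lt : ∀ p ∈ A, p.1 < L ∧ p.2 < L
  symm_swap : ∀ a b : ℕ, (a, b) ∈ A → (b, a) ∈ A
  symm_reflect : ∀ a b : ℕ, (a, b) ∈ A → (L - 1 - a, b) ∈ A
  connected : IsConnected
    (⋃ p ∈ A, Set.Icc (((p.1 : ℝ) / L, (p.2 : ℝ) / L) : ℝ × ℝ)
      ((((p.1 : ℝ) + 1) / L, ((p.2 : ℝ) + 1) / L) : ℝ × ℝ))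
  flat_border : ∀ a b : ℕ, a < L → b < L →
    (a = 0 ∨ a = L - 1 ∨ b = 0 ∨ b = L - 1) → (a, b) ∈ A
  proper : ∃ a b : ℕ, a < L ∧ b < L ∧ (a, b) ∉ A

/-- The generalized Sierpiński carpet `F`. -/
def carpetF (L : ℕ) (A : Finset (ℕ × ℕ)) : Set (ℝ × ℝ) :=
  ⋂ n : ℕ, ⋃ w : Word A n, PsiW L w '' Set.Icc (((0 : ℝ), (0 : ℝ)) : ℝ × ℝ) ((1 : ℝ), (1 : ℝ))


/-! ### Discrete crossing lemma -/

/-- a unit step of the integer grid -/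
def ustep (u v : ℤ × ℤ) : Prop :=
  (u.1 = v.1 ∧ (v.2 = u.2 + 1 ∨ v.2 = u.2 - 1)) ∨ (u.2 = v.2 ∧ (v.1 = u.1 + 1 ∨ v.1 = u.1 - 1))

def hgt (u : ℤ × ℤ) : ℤ := if 0 ≤ u.2 then 1 else 0

def crs (u v : ℤ × ℤ) : ℤ := if 1 ≤ u.1 ∧ 1 ≤ v.1 then hgt v - hgt u else 0

lemma crs_square (p p' q q' : ℤ × ℤ) (hp : ustep p p') (hq : ustep q q')
    (h1 : p ≠ q) (h2 : p' ≠ q) (h3 : p ≠ q') (h4 : p' ≠ q') :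
    crs (p - q) (p' - q) + crs (p' - q) (p' - q') =
      crs (p - q) (p - q') + crs (p - q') (p' - q') := by
  obtain ⟨a, b⟩ := p
  obtain ⟨a', b'⟩ := p'
  obtain ⟨c, d⟩ := q
  obtain ⟨c', d'⟩ := q'
  simp only [ustep, Prod.mk.injEq, ne_eq, not_and_or] at *
  simp only [crs, hgt, Prod.fst_sub, Prod.snd_sub]
  rcases hp with ⟨hp, hp' | hp'⟩ | ⟨hp, hp' | hp'⟩ <;>
  rcases hq with ⟨hq, hq' | hq'⟩ | ⟨hq, hq' | hq'⟩ <;> subst hp hp' hq hq' <;>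
  (split_ifs <;> omega)

lemma crossing_strict (p q : ℕ → ℤ × ℤ) (a b : ℕ)
    (hp : ∀ i < a, ustep (p i) (p (i + 1))) (hq : ∀ j < b, ustep (q j) (q (j + 1)))
    (hx0 : ∀ j ≤ b, (p 0).1 ≤ (q j).1) (hxa : ∀ j ≤ b, (q j).1 ≤ (p a).1)
    (hy0 : ∀ i ≤ a, (q 0).2 < (p i).2) (hyb : ∀ i ≤ a, (p i).2 < (q b).2) :
    ∃ i ≤ a, ∃ j ≤ b, p i = q j := by
  by_contra! hne
  set W : ℕ → ℤ := fun j => ∑ i ∈ range a, crs (p i - q j) (p (i + 1) - q j) with hW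
  have hW0 : W 0 = 0 := by
    apply Finset.sum_eq_zero
    intro i hi
    have hi := Finset.mem_range.1 hi
    have h1 := hy0 i hi.le
    have h2 := hy0 (i + 1) hi
    simp only [crs, hgt, Prod.fst_sub, Prod.snd_sub]
    split_ifs <;> omega
  have hWb : W b = 0 := by
    apply Finset.sum_eq_zero
    intro i hi
    have hi := Finset.mem_range.1 hi
    have h1 := hyb i hi.le
    have h2 := hyb (i + 1) hi
    simp only [crs, hgt, Prod.fst_sub, Prod.snd_sub]
    split_ifs <;> omega
  have hstep : ∀ j < b, W (j + 1) - W j = hgt (p a - q (j + 1)) - hgt (p a - q j) := by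
    intro j hj
    have key : W (j + 1) - W j = ∑ i ∈ range a,
        (crs (p (i + 1) - q j) (p (i + 1) - q (j + 1)) - crs (p i - q j) (p i - q (j + 1))) := by
      rw [hW, ← Finset.sum_sub_distrib]
      apply Finset.sum_congr rfl
      intro i hi
      have hi := Finset.mem_range.1 hi
      have := crs_square (p i) (p (i + 1)) (q j) (q (j + 1)) (hp i hi) (hq j hj)
        (hne i hi.le j hj.le) (hne _ hi j hj.le) (hne i hi.le _ hj) (hne _ hi _ hj)
      omega
    rw [key, Finset.sum_range_sub (fun i => crs (p i - q j) (p i - q (j + 1)))]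
    have e1 := hx0 j hj.le
    have e2 := hx0 (j + 1) hj
    have e3 := hxa j hj.le
    have e4 := hxa (j + 1) hj
    have s := hq j hj
    have n1 := hne a le_rfl j hj.le
    have n2 := hne a le_rfl (j + 1) hj
    simp only [ustep, ne_eq, Prod.ext_iff, not_and_or] at s n1 n2
    simp only [crs, hgt, Prod.fst_sub, Prod.snd_sub]
    split_ifs <;> omega
  have hsum : ∑ j ∈ range b, (W (j + 1) - W j) =
      ∑ j ∈ range b, (hgt (p a - q (j + 1)) - hgt (p a - q j)) :=
    Finset.sum_congr rfl fun j hj => hstep j (Finset.mem_range.1 hj)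
  rw [Finset.sum_range_sub, Finset.sum_range_sub (fun j => hgt (p a - q j)), hW0, hWb] at hsum
  have h1 := hy0 a le_rfl
  have h2 := hyb a le_rfl
  simp only [hgt, Prod.snd_sub] at hsum
  split_ifs at hsum <;> omega

lemma crossing (p q : ℕ → ℤ × ℤ) (a b : ℕ)
    (hp : ∀ i < a, ustep (p i) (p (i + 1))) (hq : ∀ j < b, ustep (q j) (q (j + 1)))
    (hx0 : ∀ j ≤ b, (p 0).1 ≤ (q j).1) (hxa : ∀ j ≤ b, (q j).1 ≤ (p a).1)
    (hy0 : ∀ i ≤ a, (q 0).2 ≤ (p i).2) (hyb : ∀ i ≤ a, (p i).2 ≤ (q b).2) :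
    ∃ i ≤ a, ∃ j ≤ b, p i = q j := by
  set q' : ℕ → ℤ × ℤ := fun j =>
    if j = 0 then ((q 0).1, (q 0).2 - 1) else
      if j = b + 2 then ((q b).1, (q b).2 + 1) else q (j - 1) with hq'
  have q0 : q' 0 = ((q 0).1, (q 0).2 - 1) := by simp [hq']
  have qb : q' (b + 2) = ((q b).1, (q b).2 + 1) := by simp [hq']
  have qm : ∀ j ≤ b, q' (j + 1) = q j := by
    intro j hj
    have : j + 1 ≠ b + 2 := by omega
    simp only [hq', this, if_false, Nat.add_sub_cancel]
    simp
  have hcase : ∀ j ≤ b + 2, j = 0 ∨ j = b + 2 ∨ ∃ k ≤ b, j = k + 1 := by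
    intro j hj
    rcases Nat.eq_zero_or_pos j with h | h
    · exact Or.inl h
    · by_cases h2 : j = b + 2
      · exact Or.inr (Or.inl h2)
      · exact Or.inr (Or.inr ⟨j - 1, by omega, by omega⟩)
  obtain ⟨i, hi, j, hj, hij⟩ := crossing_strict p q' a (b + 2) hp (by
      intro j hj
      rcases hcase j (by omega) with rfl | h | ⟨k, hk, rfl⟩
      · rw [q0, qm 0 (Nat.zero_le _)]
        left; simp
      · omega
      · rw [qm k hk]
        by_cases h : k = b
        · subst h
          rw [qb]; left; simp
        · rw [qm (k + 1) (by omega)]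
          exact hq k (by omega))
    (by
      intro j hj
      rcases hcase j hj with rfl | rfl | ⟨k, hk, rfl⟩
      · rw [q0]; exact hx0 0 (Nat.zero_le _)
      · rw [qb]; exact hx0 b le_rfl
      · rw [qm k hk]; exact hx0 k hk)
    (by
      intro j hj
      rcases hcase j hj with rfl | rfl | ⟨k, hk, rfl⟩
      · rw [q0]; exact hxa 0 (Nat.zero_le _)
      · rw [qb]; exact hxa b le_rfl
      · rw [qm k hk]; exact hxa k hk)
    (by intro i hi; rw [q0]; have := hy0 i hi; simp only; omega)
    (by intro i hi; rw [qb]; have := hyb i hi; simp only; omega)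
  refine ⟨i, hi, ?_⟩
  rcases hcase j hj with rfl | rfl | ⟨k, hk, rfl⟩
  · rw [q0] at hij
    have := hy0 i hi
    rw [hij] at this
    simp only at this; omega
  · rw [qb] at hij
    have := hyb i hi
    rw [hij] at this
    simp only at this; omega
  · exact ⟨k, hk, by rw [hij, qm k hk]⟩

/-! ### Short paths -/

/-- `x` is reached from `S` along `R`-edges with oscillation at most `r`. -/
def Reach (R : ℤ × ℤ → ℤ × ℤ → Prop) (S : Set (ℤ × ℤ)) (F : ℤ × ℤ → ℝ) (x : ℤ × ℤ) (r : ℝ) : Prop :=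
  ∃ (a : ℕ) (p : ℕ → ℤ × ℤ), p 0 ∈ S ∧ p a = x ∧ (∀ i < a, R (p i) (p (i + 1))) ∧
    ∀ i ≤ a, |F (p i) - F (p 0)| ≤ r

lemma Reach.step {R S F x r} (h : Reach R S F x r) {y} (hxy : R x y) :
    Reach R S F y (r + |F x - F y|) := by
  obtain ⟨a, p, h0, ha, hs, hr⟩ := h
  refine ⟨a + 1, fun i => if i ≤ a then p i else y, by simpa using h0, by simp, ?_, ?_⟩
  · intro i hi
    by_cases h : i = a
    · subst h; simp [ha, hxy]
    · have h1 : i ≤ a := by omega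
      have h2 : i + 1 ≤ a := by omega
      simp only [h1, h2, if_true]
      exact hs i (by omega)
  · intro i hi
    by_cases h : i ≤ a
    · simp only [h, if_true, Nat.zero_le]
      have := hr i h
      have := abs_nonneg (F x - F y)
      linarith
    · simp only [h, if_false, Nat.zero_le, if_true]
      have h1 := hr a le_rfl
      rw [ha] at h1
      have : F y - F (p 0) = (F x - F (p 0)) - (F x - F y) := by ring
      rw [this]
      exact (abs_sub _ _).trans (by linarith)

lemma Reach.nonneg {R S F x r} (h : Reach R S F x r) : 0 ≤ r := by
  obtain ⟨a, p, h0, ha, hs, hr⟩ := h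
  exact (abs_nonneg _).trans (hr 0 (Nat.zero_le _))

lemma path_or_pot (R : ℤ × ℤ → ℤ × ℤ → Prop) (hR : ∀ u v, R u v → R v u) (S T : Set (ℤ × ℤ))
    (F : ℤ × ℤ → ℝ) (l : ℝ) (hl : 0 ≤ l) :
    (∃ x ∈ T, ∃ r ≤ l, Reach R S F x r) ∨
    ∃ d : ℤ × ℤ → ℝ, (∀ x ∈ S, d x = 0) ∧ (∀ x ∈ T, d x = l) ∧
      ∀ u v, R u v → |d u - d v| ≤ |F u - F v| := by
  by_cases hT : ∃ x ∈ T, ∃ r ≤ l, Reach R S F x r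
  · exact Or.inl hT
  right
  push Not at hT
  set X : ℤ × ℤ → Set ℝ := fun x => {r | r = l ∨ Reach R S F x r} with hX
  have hbdd : ∀ x, BddBelow (X x) := fun x => ⟨0, by
    rintro r (rfl | h)
    · exact hl
    · exact h.nonneg⟩
  have hne : ∀ x, (X x).Nonempty := fun x => ⟨l, Or.inl rfl⟩
  have hlip : ∀ u v, R u v → sInf (X v) ≤ sInf (X u) + |F u - F v| := by
    intro u v huv
    rw [← sub_le_iff_le_add]
    apply le_csInf (hne u)
    rintro r (rfl | h)
    · have := csInf_le (hbdd v) (Or.inl rfl : r ∈ X v)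
      have := abs_nonneg (F u - F v)
      linarith
    · have := csInf_le (hbdd v) (Or.inr (h.step huv))
      linarith
  refine ⟨fun x => sInf (X x), ?_, ?_, ?_⟩
  · intro x hx
    apply le_antisymm
    · exact csInf_le (hbdd x) (Or.inr ⟨0, fun _ => x, hx, rfl, by simp, by simp⟩)
    · apply le_csInf (hne x)
      rintro r (rfl | h)
      · exact hl
      · exact h.nonneg
  · intro x hx
    apply le_antisymm
    · exact csInf_le (hbdd x) (Or.inl rfl)
    · apply le_csInf (hne x)
      rintro r (rfl | h)
      · exact le_rfl
      · by_contra! hr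
        exact hT x hx r hr.le h
  · intro u v huv
    have h1 := hlip u v huv
    have h2 := hlip v u (hR u v huv)
    rw [abs_sub_comm (F v)] at h2
    rw [abs_le]; constructor <;> linarith

/-! ### Cell energy on the integer grid -/

def e0 (F : ℤ × ℤ → ℝ) : ℝ :=
  (F (0, 0) - F (1, 0)) ^ 2 + (F (1, 0) - F (1, 1)) ^ 2 + (F (1, 1) - F (0, 1)) ^ 2 +
    (F (0, 1) - F (0, 0)) ^ 2

/-- translate by `L ^ n` times the cell `a` -/
def shf (L n : ℕ) (a : ℕ × ℕ) (u : ℤ × ℤ) : ℤ × ℤ :=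
  (u.1 + (a.1 : ℤ) * (L : ℤ) ^ n, u.2 + (a.2 : ℤ) * (L : ℤ) ^ n)

def En (L : ℕ) (A : Finset (ℕ × ℕ)) : ℕ → (ℤ × ℤ → ℝ) → ℝ
  | 0, F => e0 F
  | n + 1, F => ∑ a ∈ A, En L A n (fun u => F (shf L n a u))

def Edge (L : ℕ) (A : Finset (ℕ × ℕ)) : ℕ → ℤ × ℤ → ℤ × ℤ → Prop
  | 0, u, v => ustep u v ∧ 0 ≤ u.1 ∧ u.1 ≤ 1 ∧ 0 ≤ u.2 ∧ u.2 ≤ 1 ∧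
      0 ≤ v.1 ∧ v.1 ≤ 1 ∧ 0 ≤ v.2 ∧ v.2 ≤ 1
  | n + 1, u, v => ∃ a ∈ A, ∃ u' v', u = shf L n a u' ∧ v = shf L n a v' ∧ Edge L A n u' v'

section aux

variable {L : ℕ} {A : Finset (ℕ × ℕ)}

lemma ustep_symm {u v : ℤ × ℤ} (h : ustep u v) : ustep v u := by
  unfold ustep at *; omega

lemma Edge_symm (n : ℕ) : ∀ u v, Edge L A n u v → Edge L A n v u := by
  induction n with
  | zero =>
    rintro u v ⟨h, h'⟩
    exact ⟨ustep_symm h, by omega⟩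
  | succ n ih =>
    rintro u v ⟨a, ha, u', v', hu, hv, h⟩
    exact ⟨a, ha, v', u', hv, hu, ih _ _ h⟩

def inBox (M N : ℤ) (u : ℤ × ℤ) : Prop := 0 ≤ u.1 ∧ u.1 ≤ M ∧ 0 ≤ u.2 ∧ u.2 ≤ N

lemma shf_ustep {n : ℕ} {a u v} (h : ustep u v) : ustep (shf L n a u) (shf L n a v) := by
  unfold ustep shf at *
  simp only
  omega

lemma shf_box {n : ℕ} {a : ℕ × ℕ} {u} {M M' : ℕ} (h1 : a.1 < M) (h2 : a.2 < M')
    (h : inBox ((L : ℤ) ^ n) ((L : ℤ) ^ n) u) :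
    inBox (M * (L : ℤ) ^ n) (M' * (L : ℤ) ^ n) (shf L n a u) := by
  obtain ⟨h3, h4, h5, h6⟩ := h
  have hN : 0 ≤ (L : ℤ) ^ n := by positivity
  have e1 : ((a.1 : ℤ) + 1) * (L : ℤ) ^ n ≤ M * (L : ℤ) ^ n :=
    mul_le_mul_of_nonneg_right (by exact_mod_cast h1) hN
  have e2 : ((a.2 : ℤ) + 1) * (L : ℤ) ^ n ≤ M' * (L : ℤ) ^ n :=
    mul_le_mul_of_nonneg_right (by exact_mod_cast h2) hN
  have e3 : 0 ≤ (a.1 : ℤ) * (L : ℤ) ^ n := by positivity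
  have e4 : 0 ≤ (a.2 : ℤ) * (L : ℤ) ^ n := by positivity
  refine ⟨?_, ?_, ?_, ?_⟩ <;> simp only [shf] <;> linarith

lemma Edge_ustep (n : ℕ) : ∀ u v, Edge L A n u v → ustep u v := by
  induction n with
  | zero => rintro u v ⟨h, h'⟩; exact h
  | succ n ih =>
    rintro u v ⟨a, ha, u', v', rfl, rfl, h⟩
    exact shf_ustep (ih _ _ h)

lemma Edge_box (h : GoodCarpet L A) (n : ℕ) :
    ∀ u v, Edge L A n u v → inBox ((L : ℤ) ^ n) ((L : ℤ) ^ n) u := by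
  induction n with
  | zero =>
    rintro u v ⟨h, h'⟩
    unfold inBox; simp only [pow_zero]; omega
  | succ n ih =>
    rintro u v ⟨a, ha, u', v', rfl, rfl, h'⟩
    rw [pow_succ']
    exact shf_box (h.mem_lt a ha).1 (h.mem_lt a ha).2 (ih _ _ h')

lemma En_mono (n : ℕ) : ∀ F G : ℤ × ℤ → ℝ,
    (∀ u v, Edge L A n u v → |G u - G v| ≤ |F u - F v|) → En L A n G ≤ En L A n F := by
  induction n with
  | zero =>
    intro F G h
    have h1 := sq_le_sq.2 (h (0, 0) (1, 0) (by simp [Edge, ustep]))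
    have h2 := sq_le_sq.2 (h (1, 0) (1, 1) (by simp [Edge, ustep]))
    have h3 := sq_le_sq.2 (h (1, 1) (0, 1) (by simp [Edge, ustep]))
    have h4 := sq_le_sq.2 (h (0, 1) (0, 0) (by simp [Edge, ustep]))
    simp only [En, e0]; linarith
  | succ n ih =>
    intro F G h
    simp only [En]
    apply Finset.sum_le_sum
    intro a ha
    apply ih
    intro u v huv
    exact h _ _ ⟨a, ha, u, v, rfl, rfl, huv⟩

lemma En_local (h : GoodCarpet L A) (n : ℕ) (F G : ℤ × ℤ → ℝ)
    (hFG : ∀ u, inBox ((L : ℤ) ^ n) ((L : ℤ) ^ n) u → F u = G u) : En L A n F = En L A n G := by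
  apply le_antisymm <;> apply En_mono <;> intro u v huv <;>
    rw [hFG u (Edge_box h n u v huv), hFG v (Edge_box h n v u (Edge_symm n _ _ huv))]

lemma En_nonneg (n : ℕ) : ∀ F, 0 ≤ En L A n F := by
  induction n with
  | zero => intro F; simp only [En, e0]; positivity
  | succ n ih => intro F; exact Finset.sum_nonneg fun a _ => ih _

lemma En_affine (n : ℕ) (s t : ℝ) : ∀ F, En L A n (fun u => s * F u + t) = s ^ 2 * En L A n F := by
  induction n with
  | zero => intro F; simp only [En, e0]; ring
  | succ n ih =>
    intro F
    simp only [En, Finset.mul_sum]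
    exact Finset.sum_congr rfl fun a _ => ih _

lemma En_sum_le (n : ℕ) {ι : Type} (s : Finset ι) : ∀ F : ι → ℤ × ℤ → ℝ,
    En L A n (fun u => ∑ i ∈ s, F i u) ≤ (s.card : ℝ) * ∑ i ∈ s, En L A n (F i) := by
  induction n with
  | zero =>
    intro F
    simp only [En, e0, ← Finset.sum_sub_distrib, Finset.sum_add_distrib, mul_add]
    gcongr <;> exact sq_sum_le_card_mul_sum_sq
  | succ n ih =>
    intro F
    simp only [En]
    rw [Finset.sum_comm, Finset.mul_sum]
    exact Finset.sum_le_sum fun a _ => ih _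

lemma En_swap (h : GoodCarpet L A) (n : ℕ) : ∀ F, En L A n (fun u => F u.swap) = En L A n F := by
  induction n with
  | zero => intro F; simp only [En, e0, Prod.swap_prod_mk]; ring
  | succ n ih =>
    intro F
    simp only [En]
    apply Finset.sum_nbij' Prod.swap Prod.swap
    · rintro ⟨a, b⟩ hab; exact h.symm_swap a b hab
    · rintro ⟨a, b⟩ hab; exact h.symm_swap a b hab
    · simp
    · simp
    · rintro ⟨a, b⟩ hab
      rw [← ih]
      rfl

lemma En_refl (h : GoodCarpet L A) (n : ℕ) : ∀ F,
    En L A n (fun u => F ((L : ℤ) ^ n - u.1, u.2)) = En L A n F := by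
  induction n with
  | zero => intro F; simp only [En, e0]; norm_num; ring
  | succ n ih =>
    intro F
    simp only [En]
    apply Finset.sum_nbij' (fun a => (L - 1 - a.1, a.2)) (fun a => (L - 1 - a.1, a.2))
    · rintro ⟨a, b⟩ hab; exact h.symm_reflect a b hab
    · rintro ⟨a, b⟩ hab; exact h.symm_reflect a b hab
    · rintro ⟨a, b⟩ hab
      have := (h.mem_lt _ hab).1
      simp only [Prod.mk.injEq, and_true] at *; omega
    · rintro ⟨a, b⟩ hab
      have := (h.mem_lt _ hab).1
      simp only [Prod.mk.injEq, and_true] at *; omega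
    · rintro ⟨a, b⟩ hab
      have h1 := (h.mem_lt _ hab).1
      rw [← ih]
      congr 1
      funext u
      congr 1
      simp only [shf, Prod.mk.injEq, and_true] at *
      have : ((L - 1 - a : ℕ) : ℤ) = (L : ℤ) - 1 - a := by omega
      rw [this]; ring

lemma En_refl2 (h : GoodCarpet L A) (n : ℕ) (F) :
    En L A n (fun u => F (u.1, (L : ℤ) ^ n - u.2)) = En L A n F := by
  rw [← En_swap h n F, ← En_refl h n (fun u => F u.swap), ← En_swap h n]
  rfl

lemma En_corner_le (h : GoodCarpet L A) (n : ℕ) (F) : En L A n F ≤ En L A (n + 1) F := by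
  have h3 := h.three_le
  have : ((0, 0) : ℕ × ℕ) ∈ A := h.flat_border 0 0 (by omega) (by omega) (Or.inl rfl)
  have := Finset.single_le_sum (f := fun a => En L A n (fun u => F (shf L n a u)))
    (fun a _ => En_nonneg n _) this
  simpa [shf, En] using this

lemma En_row_le (h : GoodCarpet L A) (n : ℕ) (F) :
    ∑ a ∈ range L, En L A n (fun u => F (shf L n (a, 0) u)) ≤ En L A (n + 1) F := by
  have h3 := h.three_le
  simp only [En]
  rw [← Finset.sum_image (s := range L) (g := fun a : ℕ => ((a, 0) : ℕ × ℕ))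
    (f := fun a => En L A n (fun u => F (shf L n a u)))]
  · apply Finset.sum_le_sum_of_subset_of_nonneg
    · intro a ha
      simp only [Finset.mem_image, Finset.mem_range] at ha
      obtain ⟨b, hb, rfl⟩ := ha
      exact h.flat_border b 0 hb (by omega) (by simp)
    · intros; exact En_nonneg n _
  · intro a _ b _ hab; simpa using hab

lemma bottom_bound (h : GoodCarpet L A) (n : ℕ) : ∀ F,
    (F (0, 0) - F ((L : ℤ) ^ n, 0)) ^ 2 ≤ (L : ℝ) ^ n * En L A n F := by
  induction n with
  | zero =>
    intro F
    simp only [En, e0, pow_zero]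
    nlinarith [sq_nonneg (F (1, 0) - F (1, 1)), sq_nonneg (F (1, 1) - F (0, 1)),
      sq_nonneg (F (0, 1) - F (0, 0))]
  | succ n ih =>
    intro F
    have e := Finset.sum_range_sub' (fun a : ℕ => F ((a : ℤ) * (L : ℤ) ^ n, 0)) L
    simp only [Nat.cast_zero, zero_mul] at e
    rw [pow_succ' (L : ℤ), ← e]
    calc _ ≤ ((range L).card : ℝ) * ∑ a ∈ range L,
          (F ((a : ℤ) * (L : ℤ) ^ n, 0) - F (((a + 1 : ℕ) : ℤ) * (L : ℤ) ^ n, 0)) ^ 2 :=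
          sq_sum_le_card_mul_sum_sq
      _ ≤ (L : ℝ) * ∑ a ∈ range L, (L : ℝ) ^ n * En L A n (fun u => F (shf L n (a, 0) u)) := by
          rw [Finset.card_range]
          gcongr with a ha
          have := ih (fun u => F (shf L n (a, 0) u))
          simp only [shf, zero_add, Nat.cast_zero, zero_mul] at this ⊢
          have e : ((a + 1 : ℕ) : ℤ) * (L : ℤ) ^ n = (L : ℤ) ^ n + (a : ℤ) * (L : ℤ) ^ n := by
            push_cast; ring
          rw [e]; exact this
      _ ≤ (L : ℝ) * ((L : ℝ) ^ n * En L A (n + 1) F) := by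
          rw [← Finset.mul_sum]
          gcongr
          exact En_row_le h n F
      _ = _ := by ring

/-! ### The side-to-side conductance of the cell energy -/

def ccSet (L : ℕ) (A : Finset (ℕ × ℕ)) (n : ℕ) : Set ℝ :=
  {e : ℝ | ∃ F : ℤ × ℤ → ℝ, (∀ j : ℤ, 0 ≤ j → j ≤ (L : ℤ) ^ n → F (0, j) = 1) ∧
    (∀ j : ℤ, 0 ≤ j → j ≤ (L : ℤ) ^ n → F ((L : ℤ) ^ n, j) = 0) ∧ e = En L A n F}

noncomputable def cc (L : ℕ) (A : Finset (ℕ × ℕ)) (n : ℕ) : ℝ := sInf (ccSet L A n)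

lemma ccSet_bdd (n : ℕ) : BddBelow (ccSet L A n) := ⟨0, by
  rintro e ⟨F, _, _, rfl⟩; exact En_nonneg n F⟩

lemma ccSet_ne (h : GoodCarpet L A) (n : ℕ) : (ccSet L A n).Nonempty := by
  have h3 := h.three_le
  have : (L : ℤ) ^ n ≠ 0 := by positivity
  refine ⟨_, fun u => if u.1 = 0 then 1 else 0, ?_, ?_, rfl⟩
  · simp
  · intro j _ _
    simp only [if_neg this]

lemma cc_pos (h : GoodCarpet L A) (n : ℕ) : 0 < cc L A n := by
  have h3 := h.three_le
  have hL : (0 : ℝ) < (L : ℝ) ^ n := by positivity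
  refine lt_of_lt_of_le (inv_pos.2 hL) (le_csInf (ccSet_ne h n) ?_)
  rintro e ⟨F, h0, h1, rfl⟩
  have := bottom_bound h n F
  rw [h0 0 le_rfl (by positivity), h1 0 le_rfl (by positivity)] at this
  rw [inv_le_iff_one_le_mul₀' hL]
  linarith

lemma cc_le (n : ℕ) (F : ℤ × ℤ → ℝ) (α β : ℝ)
    (h0 : ∀ j : ℤ, 0 ≤ j → j ≤ (L : ℤ) ^ n → F (0, j) = α)
    (h1 : ∀ j : ℤ, 0 ≤ j → j ≤ (L : ℤ) ^ n → F ((L : ℤ) ^ n, j) = β) :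
    (α - β) ^ 2 * cc L A n ≤ En L A n F := by
  by_cases hab : α - β = 0
  · rw [hab]; simpa using En_nonneg n F
  have : cc L A n ≤ En L A n (fun u => (α - β)⁻¹ * F u + (- β * (α - β)⁻¹)) := by
    apply csInf_le (ccSet_bdd n)
    refine ⟨_, ?_, ?_, rfl⟩
    · intro j a b; simp only [h0 j a b]; field_simp; ring
    · intro j a b; simp only [h1 j a b]; ring
  rw [En_affine] at this
  calc _ ≤ (α - β) ^ 2 * ((α - β)⁻¹ ^ 2 * En L A n F) := by gcongr
    _ = _ := by field_simp

/-! ### Geometric decay -/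

def foldI (N j : ℤ) : ℤ := if j % (2 * N) ≤ N then j % (2 * N) else 2 * N - j % (2 * N)

lemma foldI_mem {N : ℤ} (hN : 0 < N) (j : ℤ) : 0 ≤ foldI N j ∧ foldI N j ≤ N := by
  have h1 := Int.emod_nonneg j (b := 2 * N) (by omega)
  have h2 := Int.emod_lt_of_pos j (b := 2 * N) (by omega)
  unfold foldI
  split_ifs <;> omega

lemma foldI_shift {N : ℤ} (hN : 0 < N) (b : ℕ) :
    (∀ j, 0 ≤ j → j ≤ N → foldI N (j + b * N) = j) ∨
    (∀ j, 0 ≤ j → j ≤ N → foldI N (j + b * N) = N - j) := by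
  rcases Nat.even_or_odd' b with ⟨k, rfl | rfl⟩
  · left
    intro j h0 h1
    have : (j + (2 * k : ℕ) * N) % (2 * N) = j := by
      have : j + (2 * k : ℕ) * N = j + (2 * N) * k := by push_cast; ring
      rw [this, Int.add_mul_emod_self_left, Int.emod_eq_of_lt h0 (by omega)]
    simp only [foldI, this, h1, if_true]
  · right
    intro j h0 h1
    by_cases hj : j = N
    · have : (j + (2 * k + 1 : ℕ) * N) % (2 * N) = 0 := by
        have : j + (2 * k + 1 : ℕ) * N = 0 + (2 * N) * (k + 1) := by rw [hj]; push_cast; ring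
        rw [this, Int.add_mul_emod_self_left, Int.zero_emod]
      simp only [foldI, this, hN.le, if_true]; omega
    · have : (j + (2 * k + 1 : ℕ) * N) % (2 * N) = j + N := by
        have : j + (2 * k + 1 : ℕ) * N = j + N + (2 * N) * k := by push_cast; ring
        rw [this, Int.add_mul_emod_self_left, Int.emod_eq_of_lt (by omega) (by omega)]
      simp only [foldI, this]
      split_ifs <;> omega

lemma growth (h : GoodCarpet L A) (n : ℕ) :
    cc L A (n + 1) ≤ ((A.card : ℝ) / (L : ℝ) ^ 2) * cc L A n := by
  have h3 := h.three_le
  have hL : (0 : ℝ) < L := by positivity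
  set N : ℤ := (L : ℤ) ^ n with hNdef
  have hN : 0 < N := by positivity
  have key : ∀ e ∈ ccSet L A n, cc L A (n + 1) ≤ ((A.card : ℝ) / (L : ℝ) ^ 2) * e := by
    rintro e ⟨g, g0, g1, rfl⟩
    rw [← hNdef] at g0 g1
    set G : ℤ × ℤ → ℝ := fun u =>
      (L : ℝ)⁻¹ * g (u.1 - u.1 / N * N, foldI N u.2) + ((L : ℝ) - 1 - ((u.1 / N : ℤ) : ℝ)) / L with hG
    have hshift : ∀ a b : ℕ, ∀ i j : ℤ, 0 ≤ i → i ≤ N → G (i + a * N, j) =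
        (L : ℝ)⁻¹ * g (i, foldI N j) + ((L : ℝ) - 1 - a) / L := by
      intro a _ i j h0 h1
      have hf := foldI_mem hN j
      by_cases hi : i = N
      · have e1 : (i + a * N) / N = a + 1 := by
          rw [hi, Int.add_mul_ediv_right _ _ hN.ne', Int.ediv_self hN.ne']; ring
        have e2 : i + a * N - (a + 1) * N = 0 := by rw [hi]; ring
        simp only [hG, e1, e2, g0 _ hf.1 hf.2]
        rw [hi, g1 _ hf.1 hf.2]
        push_cast; field_simp; ring
      · have e1 : (i + a * N) / N = a := by
          rw [Int.add_mul_ediv_right _ _ hN.ne', Int.ediv_eq_zero_of_lt h0 (by omega)]; ring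
        have e2 : i + a * N - a * N = i := by ring
        simp only [hG, e1, e2, Int.cast_natCast]
    have hE : En L A (n + 1) G = ((A.card : ℝ) / (L : ℝ) ^ 2) * En L A n g := by
      simp only [En]
      have : ∀ a ∈ A, En L A n (fun u => G (shf L n a u)) = ((L : ℝ)⁻¹) ^ 2 * En L A n g := by
        rintro ⟨a, b⟩ ha
        rcases foldI_shift hN b with hb | hb
        · rw [← En_affine n _ (((L : ℝ) - 1 - a) / L) g]
          apply En_local h
          rintro ⟨i, j⟩ ⟨h0, h1, h2, h3⟩
          simp only [shf] at *
          rw [← hNdef] at *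
          rw [hshift a b i _ h0 h1, hb j h2 h3]
        · rw [← En_refl2 h n g, ← En_affine n _ (((L : ℝ) - 1 - a) / L)]
          apply En_local h
          rintro ⟨i, j⟩ ⟨h0, h1, h2, h3⟩
          simp only [shf] at *
          rw [← hNdef] at *
          rw [hshift a b i _ h0 h1, hb j h2 h3]
      rw [Finset.sum_congr rfl this, Finset.sum_const, nsmul_eq_mul]
      field_simp
    rw [← hE]
    apply csInf_le (ccSet_bdd _)
    refine ⟨G, ?_, ?_, rfl⟩
    · intro j _ _
      have hf := foldI_mem hN j
      have := hshift 0 0 0 j le_rfl hN.le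
      simp only [Nat.cast_zero, zero_mul, add_zero] at this
      rw [this, g0 _ hf.1 hf.2]; field_simp; ring
    · intro j _ _
      have hf := foldI_mem hN j
      have := hshift (L - 1) 0 N j hN.le le_rfl
      have e : N + (L - 1 : ℕ) * N = (L : ℤ) ^ (n + 1) := by
        have : ((L - 1 : ℕ) : ℤ) = (L : ℤ) - 1 := by omega
        rw [this, pow_succ, ← hNdef]; ring
      rw [e] at this
      rw [this, g1 _ hf.1 hf.2, Nat.cast_sub (by omega)]; simp
  have hA : 0 < (A.card : ℝ) / (L : ℝ) ^ 2 := by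
    have : ((0, 0) : ℕ × ℕ) ∈ A := h.flat_border 0 0 (by omega) (by omega) (Or.inl rfl)
    have : 0 < A.card := Finset.card_pos.2 ⟨_, this⟩
    positivity
  rw [mul_comm, ← div_le_iff₀ hA]
  apply le_csInf (ccSet_ne h n)
  intro e he
  rw [div_le_iff₀ hA, mul_comm]
  exact key e he

lemma theta_lt (h : GoodCarpet L A) : (A.card : ℝ) / (L : ℝ) ^ 2 < 1 := by
  have h3 := h.three_le
  rw [div_lt_one (by positivity)]
  obtain ⟨a, b, ha, hb, hab⟩ := h.proper
  have : A ⊂ range L ×ˢ range L := by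
    rw [Finset.ssubset_iff_subset_ne]
    constructor
    · intro p hp
      simpa using h.mem_lt p hp
    · rintro rfl
      exact hab (by simp [ha, hb])
  have := Finset.card_lt_card this
  rw [Finset.card_product, Finset.card_range, ← sq] at this
  exact_mod_cast this

/-! ### Crossings of rows of cells -/

lemma row_bound (h : GoodCarpet L A) (n M : ℕ) (d : ℤ × ℤ → ℝ) (l : ℝ)
    (h0 : ∀ j : ℤ, 0 ≤ j → j ≤ (L : ℤ) ^ n → d (0, j) = 0)
    (h1 : ∀ j : ℤ, 0 ≤ j → j ≤ (L : ℤ) ^ n → d (M * (L : ℤ) ^ n, j) = l) :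
    l ^ 2 * cc L A n ≤ M * ∑ a ∈ range M, En L A n (fun u => d (shf L n (a, 0) u)) := by
  set N : ℤ := (L : ℤ) ^ n with hN
  set g : ℕ → ℤ × ℤ → ℝ := fun a u =>
    if Even a then d (shf L n (a, 0) u) else (-1) * d (shf L n (a, 0) (N - u.1, u.2)) + 0 with hg
  have hE : ∀ a, En L A n (g a) = En L A n (fun u => d (shf L n (a, 0) u)) := by
    intro a
    by_cases ha : Even a
    · simp only [hg, ha, if_true]
    · simp only [hg, ha, if_false]
      rw [En_affine n (-1) 0 (fun u : ℤ × ℤ => d (shf L n (a, 0) (N - u.1, u.2))),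
        En_refl h n (fun u => d (shf L n (a, 0) u))]
      ring
  have hl : ∀ (K : ℕ) (j : ℤ), (∑ a ∈ range K, g a (0, j) =
      if Even K then d (0, j) - d (K * N, j) else d (0, j)) ∧
      (∑ a ∈ range K, g a (N, j) = if Even K then 0 else d (K * N, j)) := by
    intro K j
    induction K with
    | zero => simp
    | succ K ih =>
      rw [Finset.sum_range_succ, Finset.sum_range_succ, ih.1, ih.2]
      have e1 : N + K * N = (K + 1) * N := by ring
      have e2 : N - 0 + K * N = (K + 1) * N := by ring
      have e3 : N - N + K * N = K * N := by ring
      by_cases hK : Even K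
      · have hK' : ¬ Even (K + 1) := by rw [Nat.even_add_one]; simpa using hK
        simp only [hg, hK, hK', if_true, if_false, shf, ← hN, Nat.cast_add, Nat.cast_one, e1]
        simp
      · have hK' : Even (K + 1) := by rw [Nat.even_add_one]; exact hK
        simp only [hg, hK, hK', if_true, if_false, shf, ← hN, Nat.cast_add, Nat.cast_one, e2, e3]
        simp
        ring
  have hcard := En_sum_le (L := L) (A := A) n (range M) g
  rw [Finset.card_range, Finset.sum_congr rfl fun a _ => hE a] at hcard
  refine le_trans ?_ hcard
  by_cases hM : Even M
  · have := cc_le (L := L) (A := A) n (fun u => ∑ a ∈ range M, g a u) (0 - l) 0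
      (by intro j a b; simp only [(hl M j).1, hM, if_true, h0 j a b, h1 j a b])
      (by intro j a b; simp only [← hN, (hl M j).2, hM, if_true])
    simpa using this
  · have := cc_le (L := L) (A := A) n (fun u => ∑ a ∈ range M, g a u) 0 l
      (by intro j a b; simp only [(hl M j).1, hM, if_false, h0 j a b])
      (by intro j a b; simp only [← hN, (hl M j).2, hM, if_false, h1 j a b])
    simpa using this

lemma hcross (h : GoodCarpet L A) (n M : ℕ) (F : ℤ × ℤ → ℝ) (l : ℝ) (hl : 0 ≤ l)
    (hE : M * ∑ a ∈ range M, En L A n (fun u => F (shf L n (a, 0) u)) < l ^ 2 * cc L A n) :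
    ∃ (a : ℕ) (p : ℕ → ℤ × ℤ), (∀ i < a, ustep (p i) (p (i + 1))) ∧ (p 0).1 = 0 ∧
      (p a).1 = M * (L : ℤ) ^ n ∧ (∀ i ≤ a, inBox (M * (L : ℤ) ^ n) ((L : ℤ) ^ n) (p i)) ∧
      ∀ i ≤ a, |F (p i) - F (p 0)| ≤ l := by
  set N : ℤ := (L : ℤ) ^ n with hN
  have hN0 : 0 ≤ N := by positivity
  set R : ℤ × ℤ → ℤ × ℤ → Prop := fun u v =>
    ∃ a < M, ∃ u' v', u = shf L n (a, 0) u' ∧ v = shf L n (a, 0) v' ∧ Edge L A n u' v' with hR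
  rcases path_or_pot R (by
      rintro u v ⟨a, ha, u', v', hu, hv, h⟩
      exact ⟨a, ha, v', u', hv, hu, Edge_symm n _ _ h⟩)
      {u | u.1 = 0 ∧ 0 ≤ u.2 ∧ u.2 ≤ N} {u | u.1 = M * N ∧ 0 ≤ u.2 ∧ u.2 ≤ N} F l hl with
    ⟨x, hx, r, hr, a, p, p0, pa, ps, po⟩ | ⟨d, d0, d1, dR⟩
  · have hbox : ∀ u v, R u v → inBox (M * N) N u := by
      rintro u v ⟨a, ha, u', v', rfl, rfl, he⟩
      have := shf_box (L := L) (n := n) (a := (a, 0)) (M := M) (M' := 1) ha Nat.zero_lt_one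
        (Edge_box h n _ _ he)
      simpa using this
    refine ⟨a, p, ?_, p0.1, by rw [pa]; exact hx.1, ?_, fun i hi => (po i hi).trans hr⟩
    · intro i hi
      obtain ⟨b, hb, u', v', hu, hv, he⟩ := ps i hi
      rw [hu, hv]
      exact shf_ustep (Edge_ustep n _ _ he)
    · intro i hi
      by_cases hia : i = a
      · rw [hia, pa]
        obtain ⟨x1, x2, x3⟩ := hx
        refine ⟨?_, ?_, x2, x3⟩
        · rw [x1]; positivity
        · rw [x1]
      · exact hbox _ _ (ps i (by omega))
  · exfalso
    have := row_bound h n M d l (fun j a b => d0 _ ⟨rfl, a, b⟩) (fun j a b => d1 _ ⟨rfl, a, b⟩)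
    have h2 : ∑ a ∈ range M, En L A n (fun u => d (shf L n (a, 0) u)) ≤
        ∑ a ∈ range M, En L A n (fun u => F (shf L n (a, 0) u)) := by
      apply Finset.sum_le_sum
      intro a ha
      apply En_mono
      intro u v huv
      exact dR _ _ ⟨a, Finset.mem_range.1 ha, u, v, rfl, rfl, huv⟩
    have h3 := mul_le_mul_of_nonneg_left h2 (Nat.cast_nonneg (α := ℝ) M)
    linarith

/-- a vertical crossing of the square of side `N` -/
def VCross (N : ℤ) (b : ℕ) (q : ℕ → ℤ × ℤ) : Prop :=
  (∀ i < b, ustep (q i) (q (i + 1))) ∧ (q 0).2 = 0 ∧ (q b).2 = N ∧ ∀ i ≤ b, inBox N N (q i)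

def HCross (M N : ℤ) (b : ℕ) (q : ℕ → ℤ × ℤ) : Prop :=
  (∀ i < b, ustep (q i) (q (i + 1))) ∧ (q 0).1 = 0 ∧ (q b).1 = M ∧ ∀ i ≤ b, inBox M N (q i)

lemma cross_meet {M N N' : ℤ} {a b : ℕ} {p q : ℕ → ℤ × ℤ} (hp : HCross M N a p)
    (hq : VCross N' b q) (h1 : N' ≤ M) (h2 : N ≤ N') : ∃ i ≤ a, ∃ j ≤ b, p i = q j := by
  obtain ⟨p1, p2, p3, p4⟩ := hp
  obtain ⟨q1, q2, q3, q4⟩ := hq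
  apply crossing p q a b p1 q1
  · intro j hj; rw [p2]; exact (q4 j hj).1
  · intro j hj; rw [p3]; exact (q4 j hj).2.1.trans h1
  · intro j hj; rw [q2]; exact (p4 j hj).2.2.1
  · intro j hj; rw [q3]; exact (p4 j hj).2.2.2.trans h2

lemma hsquare (h : GoodCarpet L A) (n : ℕ) (F : ℤ × ℤ → ℝ) (κ : ℝ) (hκ : 0 < κ)
    (hE : En L A n F < κ ^ 2) :
    ∃ b q, HCross ((L : ℤ) ^ n) ((L : ℤ) ^ n) b q ∧
      ∀ i ≤ b, |F (q i) - F (q 0)| ≤ κ / √(cc L A n) := by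
  have hc := cc_pos h n
  have hs : 0 < √(cc L A n) := Real.sqrt_pos.2 hc
  obtain ⟨a, p, p1, p2, p3, p4, p5⟩ := hcross h n 1 F (κ / √(cc L A n)) (by positivity) (by
    rw [div_pow, Real.sq_sqrt hc.le, div_mul_cancel₀ _ hc.ne']
    simpa [shf] using hE)
  simp only [Nat.cast_one, one_mul] at p3 p4
  exact ⟨a, p, ⟨p1, p2, p3, p4⟩, p5⟩

lemma vsquare (h : GoodCarpet L A) (n : ℕ) (F : ℤ × ℤ → ℝ) (κ : ℝ) (hκ : 0 < κ)
    (hE : En L A n F < κ ^ 2) :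
    ∃ b q, VCross ((L : ℤ) ^ n) b q ∧ ∀ i ≤ b, |F (q i) - F (q 0)| ≤ κ / √(cc L A n) := by
  obtain ⟨b, q, ⟨q1, q2, q3, q4⟩, q5⟩ := hsquare h n (fun u => F u.swap) κ hκ
    (by rw [En_swap h n]; exact hE)
  refine ⟨b, fun i => (q i).swap, ⟨?_, q2, q3, ?_⟩, q5⟩
  · intro i hi
    have := q1 i hi
    unfold ustep at *
    simp only [Prod.fst_swap, Prod.snd_swap]; omega
  · intro i hi
    obtain ⟨a, b, c, d⟩ := q4 i hi
    exact ⟨c, d, a, b⟩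

lemma hrow (h : GoodCarpet L A) (n : ℕ) (F : ℤ × ℤ → ℝ) (κ : ℝ) (hκ : 0 < κ)
    (hE : En L A (n + 1) F < κ ^ 2) :
    ∃ b q, HCross ((L : ℤ) ^ (n + 1)) ((L : ℤ) ^ n) b q ∧
      ∀ i ≤ b, |F (q i) - F (q 0)| ≤ √L * κ / √(cc L A n) := by
  have hc := cc_pos h n
  have h3 := h.three_le
  have hs : 0 < √(cc L A n) := Real.sqrt_pos.2 hc
  obtain ⟨a, p, p1, p2, p3, p4, p5⟩ := hcross h n L F (√L * κ / √(cc L A n)) (by positivity) (by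
    rw [div_pow, Real.sq_sqrt hc.le, div_mul_cancel₀ _ hc.ne', mul_pow,
      Real.sq_sqrt (Nat.cast_nonneg L)]
    have := En_row_le h n F
    have hL : (0 : ℝ) < L := by positivity
    exact mul_lt_mul_of_pos_left (this.trans_lt hE) hL)
  rw [pow_succ']
  exact ⟨a, p, ⟨p1, p2, p3, p4⟩, p5⟩

lemma sqrt_growth (h : GoodCarpet L A) (n : ℕ) :
    (√(cc L A n))⁻¹ ≤ √((A.card : ℝ) / (L : ℝ) ^ 2) * (√(cc L A (n + 1)))⁻¹ := by
  have hs : 0 < √(cc L A n) := Real.sqrt_pos.2 (cc_pos h n)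
  have hs' : 0 < √(cc L A (n + 1)) := Real.sqrt_pos.2 (cc_pos h (n + 1))
  have := Real.sqrt_le_sqrt (growth h n)
  rw [Real.sqrt_mul (by positivity)] at this
  rw [← div_eq_mul_inv, le_div_iff₀ hs', inv_mul_le_iff₀ hs]
  linarith

lemma corner_chain (h : GoodCarpet L A) : ∃ K : ℝ, 0 < K ∧ ∀ n, ∀ F : ℤ × ℤ → ℝ, ∀ κ : ℝ, 0 < κ →
    En L A n F < κ ^ 2 → ∃ b q, VCross ((L : ℤ) ^ n) b q ∧
      ∀ i ≤ b, |F (0, 0) - F (q i)| ≤ K * κ * (√(cc L A n))⁻¹ := by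
  have h3 := h.three_le
  set t := √((A.card : ℝ) / (L : ℝ) ^ 2) with ht
  have ht1 : t < 1 := by rw [ht, Real.sqrt_lt' one_pos]; simpa using theta_lt h
  have ht0 : 0 ≤ t := Real.sqrt_nonneg _
  have ht2 : 0 < 1 - t := by linarith
  set K : ℝ := √(cc L A 0) + 1 + (2 * √L + 2) / (1 - t) with hK
  have hK1 : √(cc L A 0) + 1 ≤ K := by
    have : 0 ≤ (2 * √L + 2) / (1 - t) := by positivity
    linarith
  have hK2 : 2 * √L + 2 ≤ K * (1 - t) := by
    rw [hK, add_mul, div_mul_cancel₀ _ ht2.ne']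
    have : 0 ≤ (√(cc L A 0) + 1) * (1 - t) := by positivity
    linarith
  have hK0 : 0 < K := lt_of_lt_of_le (by positivity) hK1
  refine ⟨K, hK0, ?_⟩
  intro n
  induction n with
  | zero =>
    intro F κ hκ hE
    obtain ⟨b, q, hq, hosc⟩ := vsquare h 0 F κ hκ hE
    refine ⟨b, q, hq, ?_⟩
    intro i hi
    have hs : 0 < √(cc L A 0) := Real.sqrt_pos.2 (cc_pos h 0)
    have h0 : |F (0, 0) - F (q 0)| ≤ κ := by
      obtain ⟨q1, q2, q3, q4⟩ := hq
      obtain ⟨x1, x2, _⟩ := q4 0 (Nat.zero_le _)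
      rw [pow_zero] at x2
      have : q 0 = (0, 0) ∨ q 0 = (1, 0) := by
        simp only [Prod.ext_iff]; omega
      rcases this with e | e
      · rw [e]; simpa using hκ.le
      · rw [e]
        refine abs_le_of_sq_le_sq ?_ hκ.le
        simp only [En, e0] at hE
        nlinarith [sq_nonneg (F (1, 0) - F (1, 1)), sq_nonneg (F (1, 1) - F (0, 1)),
          sq_nonneg (F (0, 1) - F (0, 0))]
    have h1 := hosc i hi
    have h2 : |F (0, 0) - F (q i)| ≤ κ + κ / √(cc L A 0) := by
      rw [abs_le] at *; constructor <;> linarith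
    refine h2.trans ?_
    have : κ + κ / √(cc L A 0) = (√(cc L A 0) + 1) * κ * (√(cc L A 0))⁻¹ := by
      field_simp
    rw [this]
    gcongr
  | succ n ih =>
    intro F κ hκ hE
    have hL1 : (1 : ℤ) ≤ L := by omega
    have hpow : (L : ℤ) ^ n ≤ (L : ℤ) ^ (n + 1) := pow_le_pow_right₀ hL1 (Nat.le_succ n)
    obtain ⟨b, q, hq, hqF⟩ := ih F κ hκ ((En_corner_le h n F).trans_lt hE)
    obtain ⟨b', q', hq', hqF'⟩ := vsquare h (n + 1) F κ hκ hE
    obtain ⟨a, p, hp, hpF⟩ := hrow h n F κ hκ hE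
    obtain ⟨i₁, hi₁, j₁, hj₁, e₁⟩ := cross_meet hp hq hpow le_rfl
    obtain ⟨i₂, hi₂, j₂, hj₂, e₂⟩ := cross_meet hp hq' le_rfl hpow
    refine ⟨b', q', hq', ?_⟩
    intro i hi
    have f1 := hqF j₁ hj₁
    have f2 := hpF i₁ hi₁
    have f3 := hpF i₂ hi₂
    have f4 := hqF' j₂ hj₂
    have f5 := hqF' i hi
    rw [e₁] at f2
    rw [e₂] at f3
    have hs : 0 < (√(cc L A n))⁻¹ := inv_pos.2 (Real.sqrt_pos.2 (cc_pos h n))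
    have hs' : 0 < (√(cc L A (n + 1)))⁻¹ := inv_pos.2 (Real.sqrt_pos.2 (cc_pos h (n + 1)))
    have hg := sqrt_growth h n
    rw [div_eq_mul_inv] at f2 f3 f4 f5
    set s := (√(cc L A n))⁻¹
    set s' := (√(cc L A (n + 1)))⁻¹
    have : |F (0, 0) - F (q' i)| ≤ K * κ * s + 2 * (√L * κ * s) + 2 * (κ * s') := by
      rw [abs_le] at *; constructor <;> linarith
    refine this.trans ?_
    calc K * κ * s + 2 * (√L * κ * s) + 2 * (κ * s')
        = ((K + 2 * √L) * κ) * s + 2 * (κ * s') := by ring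
      _ ≤ ((K + 2 * √L) * κ) * (t * s') + 2 * (κ * s') := by gcongr
      _ = ((K + 2 * √L) * t + 2) * (κ * s') := by ring
      _ ≤ K * (κ * s') := by
          gcongr
          have : 0 ≤ √(L : ℝ) := Real.sqrt_nonneg _
          nlinarith
      _ = K * κ * s' := by ring

lemma corner_corner (h : GoodCarpet L A) : ∃ K : ℝ, 0 < K ∧ ∀ n, ∀ F : ℤ × ℤ → ℝ,
    (F (0, 0) - F ((L : ℤ) ^ n, 0)) ^ 2 * cc L A n ≤ K * En L A n F := by
  obtain ⟨K, hK, hc⟩ := corner_chain h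
  refine ⟨(2 * K + 2) ^ 2, by positivity, ?_⟩
  intro n F
  have hcc := cc_pos h n
  have hs : 0 < √(cc L A n) := Real.sqrt_pos.2 hcc
  have key : ∀ κ : ℝ, 0 < κ → En L A n F < κ ^ 2 →
      (F (0, 0) - F ((L : ℤ) ^ n, 0)) ^ 2 * cc L A n ≤ (2 * K + 2) ^ 2 * κ ^ 2 := by
    intro κ hκ hE
    obtain ⟨b, q, hq, hqF⟩ := hc n F κ hκ hE
    obtain ⟨b', q', ⟨r1, r2, r3, r4⟩, hqF'⟩ := hc n (fun u => F ((L : ℤ) ^ n - u.1, u.2)) κ hκ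
      (by rw [En_refl h n]; exact hE)
    obtain ⟨a, p, hp, hpF⟩ := hsquare h n F κ hκ hE
    have hq'' : VCross ((L : ℤ) ^ n) b' (fun i => ((L : ℤ) ^ n - (q' i).1, (q' i).2)) := by
      refine ⟨?_, r2, r3, ?_⟩
      · intro i hi
        have := r1 i hi
        unfold ustep at *
        simp only; omega
      · intro i hi
        obtain ⟨x, y, z, w⟩ := r4 i hi
        refine ⟨?_, ?_, z, w⟩ <;> simp only <;> omega
    obtain ⟨i₁, hi₁, j₁, hj₁, e₁⟩ := cross_meet hp hq le_rfl le_rfl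
    obtain ⟨i₂, hi₂, j₂, hj₂, e₂⟩ := cross_meet hp hq'' le_rfl le_rfl
    have f1 := hqF j₁ hj₁
    have f2 := hpF i₁ hi₁
    have f3 := hpF i₂ hi₂
    have f4 := hqF' j₂ hj₂
    rw [e₁] at f2
    rw [e₂] at f3
    simp only [sub_zero] at f4
    rw [div_eq_mul_inv] at f2 f3
    have : |F (0, 0) - F ((L : ℤ) ^ n, 0)| ≤ (2 * K + 2) * κ * (√(cc L A n))⁻¹ := by
      rw [abs_le] at *; constructor <;> linarith
    have h2 := pow_le_pow_left₀ (abs_nonneg _) this 2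
    rw [sq_abs, mul_pow, inv_pow, Real.sq_sqrt hcc.le] at h2
    calc _ ≤ ((2 * K + 2) * κ) ^ 2 * (cc L A n)⁻¹ * cc L A n := by gcongr
      _ = _ := by rw [inv_mul_cancel_right₀ hcc.ne']; ring
  rw [← div_le_iff₀' (by positivity)]
  apply le_of_forall_gt_imp_ge_of_dense
  intro e he
  have he0 : 0 < e := (En_nonneg n F).trans_lt he
  have := key (√e) (Real.sqrt_pos.2 he0) (by rwa [Real.sq_sqrt he0.le])
  rw [Real.sq_sqrt he0.le] at this
  rwa [div_le_iff₀' (by positivity)]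

/-! ### Relation with the real-coordinate model -/

lemma PsiW_succ {n : ℕ} (w : Word A (n + 1)) :
    PsiW L w = Psi L (w 0).1 ∘ PsiW L (fun i : Fin n => w i.succ) := by
  simp [PsiW, List.ofFn_succ]

def cel (L : ℕ) {A : Finset (ℕ × ℕ)} : (n : ℕ) → Word A n → ℕ × ℕ
  | 0, _ => (0, 0)
  | n + 1, w => ((cel L n (fun i : Fin n => w i.succ)).1 + (w 0).1.1 * L ^ n,
      (cel L n (fun i : Fin n => w i.succ)).2 + (w 0).1.2 * L ^ n)

lemma cel_lt (h : GoodCarpet L A) (n : ℕ) : ∀ w : Word A n,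
    (cel L n w).1 < L ^ n ∧ (cel L n w).2 < L ^ n := by
  induction n with
  | zero => intro w; simp [cel]
  | succ n ih =>
    intro w
    have h1 := ih (fun i : Fin n => w i.succ)
    have h2 := h.mem_lt _ (w 0).2
    simp only [cel, pow_succ']
    constructor
    · have := Nat.mul_le_mul_right (L ^ n) h2.1
      rw [Nat.succ_mul] at this; omega
    · have := Nat.mul_le_mul_right (L ^ n) h2.2
      rw [Nat.succ_mul] at this; omega

lemma digit_inj {N a b c d : ℕ} (ha : a < N) (hb : b < N) (h : a + c * N = b + d * N) :
    a = b ∧ c = d := by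
  have hN : 0 < N := by omega
  have h1 : (a + c * N) % N = (b + d * N) % N := by rw [h]
  rw [Nat.add_mul_mod_self_right, Nat.add_mul_mod_self_right, Nat.mod_eq_of_lt ha,
    Nat.mod_eq_of_lt hb] at h1
  refine ⟨h1, ?_⟩
  subst h1
  exact Nat.eq_of_mul_eq_mul_right hN (by omega)

lemma cel_inj (h : GoodCarpet L A) (n : ℕ) : ∀ w w' : Word A n, cel L n w = cel L n w' → w = w' := by
  induction n with
  | zero => intro w w' _; exact Subsingleton.elim _ _
  | succ n ih =>
    intro w w' e
    simp only [cel, Prod.mk.injEq] at e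
    have h1 := cel_lt h n (fun i : Fin n => w i.succ)
    have h2 := cel_lt h n (fun i : Fin n => w' i.succ)
    have d1 := digit_inj h1.1 h2.1 e.1
    have d2 := digit_inj h1.2 h2.2 e.2
    have h0 : w 0 = w' 0 := Subtype.ext (Prod.ext d1.2 d2.2)
    have hs := ih _ _ (Prod.ext d1.1 d2.1)
    funext i
    refine Fin.cases h0 (fun j => ?_) i
    exact congrFun hs j

lemma PsiW_eq (h : GoodCarpet L A) (n : ℕ) : ∀ (w : Word A n) (p : ℝ × ℝ),
    PsiW L w p = ((p.1 + (cel L n w).1) / (L : ℝ) ^ n, (p.2 + (cel L n w).2) / (L : ℝ) ^ n) := by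
  have h3 := h.three_le
  have hL : (L : ℝ) ≠ 0 := by positivity
  induction n with
  | zero => intro w p; simp [PsiW, cel]
  | succ n ih =>
    intro w p
    rw [PsiW_succ, Function.comp, ih]
    simp only [Psi, cel, Prod.mk.injEq]
    push_cast
    constructor <;> (field_simp; try ring)

/-- energy of a function on the four corners of the unit square -/
def e4 (g : ℝ × ℝ → ℝ) : ℝ :=
  (g (0, 0) - g (1, 0)) ^ 2 + (g (1, 0) - g (1, 1)) ^ 2 + (g (1, 1) - g (0, 1)) ^ 2 +
    (g (0, 1) - g (0, 0)) ^ 2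

lemma En_eq (h : GoodCarpet L A) (n : ℕ) : ∀ f : ℝ × ℝ → ℝ,
    En L A n (fun u => f ((u.1 : ℝ) / (L : ℝ) ^ n, (u.2 : ℝ) / (L : ℝ) ^ n)) =
      ∑ w : Word A n, e4 (fun p => f (PsiW L w p)) := by
  have h3 := h.three_le
  have hL : (L : ℝ) ≠ 0 := by positivity
  induction n with
  | zero =>
    intro f
    simp [En, e0, e4, PsiW]
  | succ n ih =>
    intro f
    have key : ∀ a ∈ A, En L A n (fun u => (fun u : ℤ × ℤ =>
        f ((u.1 : ℝ) / (L : ℝ) ^ (n + 1), (u.2 : ℝ) / (L : ℝ) ^ (n + 1))) (shf L n a u)) =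
        ∑ w : Word A n, e4 (fun p => f (Psi L a (PsiW L w p))) := by
      intro a _
      rw [← ih (fun x => f (Psi L a x))]
      congr 1
      funext u
      simp only [shf, Psi]
      congr 1
      push_cast
      simp only [Prod.mk.injEq]
      constructor <;> (field_simp; try ring)
    rw [En, Finset.sum_congr rfl key, ← Finset.sum_coe_sort A]
    rw [← Fintype.sum_prod_type' (f := fun (a : {p // p ∈ A}) (w : Word A n) =>
      e4 (fun p => f (Psi L a.1 (PsiW L w p))))]
    apply Fintype.sum_equiv (Fin.consEquiv (fun _ : Fin (n + 1) => {p // p ∈ A}))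
    rintro ⟨a, w⟩
    simp only [PsiW_succ, Fin.consEquiv, Equiv.coe_fn_mk, Fin.cons_zero, Fin.cons_succ,
      Function.comp]

lemma V0_sum (g : ℝ × ℝ → ℝ) :
    ∑ z ∈ (V0 ×ˢ V0).filter (fun z => eudist z.1 z.2 = 1), (g z.1 - g z.2) ^ 2 = 2 * e4 g := by
  rw [Finset.sum_filter, Finset.sum_product]
  simp only [V0, eudist, Real.sqrt_eq_one]
  repeat rw [Finset.sum_insert (by simp)]
  simp only [Finset.sum_singleton]
  repeat rw [Finset.sum_insert (by simp)]
  simp only [Finset.sum_singleton]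
  norm_num [e4]
  ring

/-- triples describing oriented edges of cells -/
noncomputable def tri (A : Finset (ℕ × ℕ)) (n : ℕ) : Finset (Word A n × ((ℝ × ℝ) × (ℝ × ℝ))) :=
  Finset.univ ×ˢ ((V0 ×ˢ V0).filter (fun z => eudist z.1 z.2 = 1))

noncomputable def trimap (L : ℕ) (A : Finset (ℕ × ℕ)) (n : ℕ)
    (τ : Word A n × ((ℝ × ℝ) × (ℝ × ℝ))) : (ℝ × ℝ) × (ℝ × ℝ) :=
  (PsiW L τ.1 τ.2.1, PsiW L τ.1 τ.2.2)

lemma mem_VN {n : ℕ} {x : ℝ × ℝ} : x ∈ VN L A n ↔ ∃ w : Word A n, ∃ p ∈ V0, PsiW L w p = x := by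
  simp [VN]

lemma Dform_eq (n : ℕ) (f : ℝ × ℝ → ℝ) : 2 * Dform L A n f =
    ∑ z ∈ (tri A n).image (trimap L A n), (f z.1 - f z.2) ^ 2 := by
  unfold Dform
  rw [← mul_assoc]
  norm_num only [one_mul]
  rw [← Finset.sum_product' (f := fun x y => if Adj L A n x y then (f x - f y) ^ 2 else 0),
    ← Finset.sum_filter (s := VN L A n ×ˢ VN L A n) (p := fun z => Adj L A n z.1 z.2)
      (f := fun z => (f z.1 - f z.2) ^ 2)]
  apply Finset.sum_congr _ fun _ _ => rfl
  ext ⟨x, y⟩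
  simp only [Finset.mem_filter, Finset.mem_product, Finset.mem_image, tri, trimap, Prod.exists,
    Finset.mem_univ, true_and, Prod.mk.injEq, mem_VN, Adj]
  constructor
  · rintro ⟨_, w, p1, p2, hp, q1, q2, hq, hpq, rfl, rfl⟩
    exact ⟨w, p1, p2, q1, q2, ⟨⟨hp, hq⟩, hpq⟩, rfl, rfl⟩
  · rintro ⟨w, a, b, c, d, ⟨⟨hp, hq⟩, hpq⟩, rfl, rfl⟩
    exact ⟨⟨⟨w, a, b, hp, rfl⟩, ⟨w, c, d, hq, rfl⟩⟩, w, a, b, hp, c, d, hq, hpq, rfl, rfl⟩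

lemma En_tri (h : GoodCarpet L A) (n : ℕ) (f : ℝ × ℝ → ℝ) :
    2 * En L A n (fun u => f ((u.1 : ℝ) / (L : ℝ) ^ n, (u.2 : ℝ) / (L : ℝ) ^ n)) =
      ∑ z ∈ (tri A n).image (trimap L A n),
        (#{τ ∈ tri A n | trimap L A n τ = z} : ℝ) * (f z.1 - f z.2) ^ 2 := by
  have := Finset.sum_comp (s := tri A n) (fun z : (ℝ × ℝ) × (ℝ × ℝ) => (f z.1 - f z.2) ^ 2)
    (trimap L A n)
  simp only [nsmul_eq_mul] at this
  rw [← this, En_eq h n f, tri, Finset.sum_product, Finset.mul_sum]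
  apply Finset.sum_congr rfl
  intro w _
  exact (V0_sum (fun p => f (PsiW L w p))).symm

lemma D_le_E (h : GoodCarpet L A) (n : ℕ) (f : ℝ × ℝ → ℝ) :
    Dform L A n f ≤ En L A n (fun u => f ((u.1 : ℝ) / (L : ℝ) ^ n, (u.2 : ℝ) / (L : ℝ) ^ n)) := by
  have : 2 * Dform L A n f ≤ 2 * En L A n (fun u => f ((u.1 : ℝ) / (L : ℝ) ^ n, (u.2 : ℝ) / (L : ℝ) ^ n)) := by
    rw [Dform_eq, En_tri h]
    apply Finset.sum_le_sum
    intro z hz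
    obtain ⟨τ, hτ, e⟩ := Finset.mem_image.1 hz
    have : 0 < #{τ ∈ tri A n | trimap L A n τ = z} :=
      Finset.card_pos.2 ⟨τ, Finset.mem_filter.2 ⟨hτ, e⟩⟩
    have h1 : (1 : ℝ) ≤ (#{τ ∈ tri A n | trimap L A n τ = z} : ℝ) := by exact_mod_cast this
    nlinarith [sq_nonneg (f z.1 - f z.2)]
  linarith

lemma E_le_D (h : GoodCarpet L A) (n : ℕ) (f : ℝ × ℝ → ℝ) :
    En L A n (fun u => f ((u.1 : ℝ) / (L : ℝ) ^ n, (u.2 : ℝ) / (L : ℝ) ^ n)) ≤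
      16 * Dform L A n f := by
  have h3 := h.three_le
  have hL : (L : ℝ) ^ n ≠ 0 := by positivity
  have : 2 * En L A n (fun u => f ((u.1 : ℝ) / (L : ℝ) ^ n, (u.2 : ℝ) / (L : ℝ) ^ n)) ≤
      16 * (2 * Dform L A n f) := by
    rw [Dform_eq, En_tri h, Finset.mul_sum]
    apply Finset.sum_le_sum
    intro z _
    have : #{τ ∈ tri A n | trimap L A n τ = z} ≤ (V0 ×ˢ V0).card := by
      apply Finset.card_le_card_of_injOn (fun τ => τ.2)
      · intro τ hτ
        have := (Finset.mem_filter.1 hτ).1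
        exact (Finset.mem_filter.1 (Finset.mem_product.1 this).2).1
      · rintro ⟨w, p⟩ hτ ⟨w', p'⟩ hτ' e
        simp only at e
        subst e
        have e1 := (Finset.mem_filter.1 hτ).2
        have e2 := (Finset.mem_filter.1 hτ').2
        rw [← e2] at e1
        simp only [trimap, Prod.mk.injEq] at e1
        have e3 := e1.1
        rw [PsiW_eq h, PsiW_eq h] at e3
        simp only [Prod.mk.injEq, div_left_inj' hL, add_right_inj, Nat.cast_inj] at e3
        rw [cel_inj h n w w' (Prod.ext e3.1 e3.2)]
    have h16 : (V0 ×ˢ V0).card ≤ 16 := by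
      rw [Finset.card_product]
      have : V0.card ≤ 4 := Finset.card_le_four
      nlinarith
    have h1 : (#{τ ∈ tri A n | trimap L A n τ = z} : ℝ) ≤ 16 := by exact_mod_cast this.trans h16
    exact mul_le_mul_of_nonneg_right h1 (sq_nonneg _)
  linarith

lemma VN_coord (h : GoodCarpet L A) (n : ℕ) (x : ℝ × ℝ) (hx : x ∈ VN L A n) :
    ∃ i j : ℤ, inBox ((L : ℤ) ^ n) ((L : ℤ) ^ n) (i, j) ∧
      x = ((i : ℝ) / (L : ℝ) ^ n, (j : ℝ) / (L : ℝ) ^ n) := by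
  obtain ⟨w, p, hp, rfl⟩ := mem_VN.1 hx
  have hc := cel_lt h n w
  have c1 : ((cel L n w).1 : ℤ) < (L : ℤ) ^ n := by exact_mod_cast hc.1
  have c2 : ((cel L n w).2 : ℤ) < (L : ℤ) ^ n := by exact_mod_cast hc.2
  rw [PsiW_eq h]
  simp only [V0, Finset.mem_insert, Finset.mem_singleton] at hp
  rcases hp with rfl | rfl | rfl | rfl
  · exact ⟨(cel L n w).1, (cel L n w).2, by unfold inBox; simp only; omega, by simp⟩
  · exact ⟨1 + (cel L n w).1, (cel L n w).2, by unfold inBox; simp only; omega, by simp⟩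
  · exact ⟨1 + (cel L n w).1, 1 + (cel L n w).2, by unfold inBox; simp only; omega, by simp⟩
  · exact ⟨(cel L n w).1, 1 + (cel L n w).2, by unfold inBox; simp only; omega, by simp⟩

lemma corner_mem (h : GoodCarpet L A) (n : ℕ) :
    ((0 : ℝ), (0 : ℝ)) ∈ VN L A n ∧ ((1 : ℝ), (0 : ℝ)) ∈ VN L A n := by
  have h3 := h.three_le
  have hL : (L : ℝ) ≠ 0 := by positivity
  have a0 : ((0, 0) : ℕ × ℕ) ∈ A := h.flat_border 0 0 (by omega) (by omega) (Or.inl rfl)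
  have a1 : ((L - 1, 0) : ℕ × ℕ) ∈ A := h.flat_border _ 0 (by omega) (by omega) (by simp)
  have e0 : ∀ n : ℕ, PsiW L (fun _ : Fin n => (⟨(0, 0), a0⟩ : {p // p ∈ A})) (0, 0) = (0, 0) := by
    intro n
    induction n with
    | zero => simp [PsiW]
    | succ n ih => rw [PsiW_succ, Function.comp, ih]; simp [Psi]
  have e1 : ∀ n : ℕ, PsiW L (fun _ : Fin n => (⟨(L - 1, 0), a1⟩ : {p // p ∈ A})) (1, 0) = (1, 0) := by
    intro n
    induction n with
    | zero => simp [PsiW]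
    | succ n ih =>
      rw [PsiW_succ, Function.comp, ih]
      have : ((L - 1 : ℕ) : ℝ) = (L : ℝ) - 1 := by rw [Nat.cast_sub (by omega)]; simp
      simp only [Psi, this]
      simp [hL]
  exact ⟨mem_VN.2 ⟨_, _, by simp [V0], e0 n⟩, mem_VN.2 ⟨_, _, by simp [V0], e1 n⟩⟩

end aux

/-- Proposition 3.8, planar case: the point-to-point resistance `𝓡_m`
and the side-to-side resistance `𝓡̄_m` are comparable uniformly in `m`. -/
theorem resistance_comparison (L : ℕ) (A : Finset (ℕ × ℕ)) (h : GoodCarpet L A) :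
    ∃ c : ℝ, 1 ≤ c ∧ ∀ m : ℕ,
      RRbar L A m ≤ RR L A m ∧ RR L A m ≤ c * RRbar L A m := by
  have h3 := h.three_le
  obtain ⟨K, hK, hcorner⟩ := corner_corner h
  refine ⟨max 1 (16 * K), le_max_left _ _, ?_⟩
  intro m
  have hN : (0 : ℝ) < (L : ℝ) ^ m := by positivity
  obtain ⟨m0, m1⟩ := corner_mem h m
  set SP : Set ℝ := {e : ℝ | ∃ f : ℝ × ℝ → ℝ,
      (∀ x ∈ ({((0 : ℝ), (0 : ℝ))} : Set (ℝ × ℝ)), f x = 1) ∧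
      (∀ x ∈ ({((1 : ℝ), (0 : ℝ))} : Set (ℝ × ℝ)), f x = 0) ∧ e = Dform L A m f} with hSP
  set SS : Set ℝ := {e : ℝ | ∃ f : ℝ × ℝ → ℝ,
      (∀ x ∈ (VN L A m : Set (ℝ × ℝ)) ∩ ({(0 : ℝ)} ×ˢ Set.Icc (0 : ℝ) 1), f x = 1) ∧
      (∀ x ∈ (VN L A m : Set (ℝ × ℝ)) ∩ ({(1 : ℝ)} ×ˢ Set.Icc (0 : ℝ) 1), f x = 0) ∧
      e = Dform L A m f} with hSS
  have hRR : RR L A m = (sInf SP)⁻¹ := rfl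
  have hRRb : RRbar L A m = (sInf SS)⁻¹ := rfl
  have hD0 : ∀ f, 0 ≤ Dform L A m f := by
    intro f
    have := E_le_D h m f
    have := En_nonneg (L := L) (A := A) m
      (fun u => f ((u.1 : ℝ) / (L : ℝ) ^ m, (u.2 : ℝ) / (L : ℝ) ^ m))
    linarith
  have hsub : SS ⊆ SP := by
    rintro e ⟨f, f0, f1, rfl⟩
    refine ⟨f, ?_, ?_, rfl⟩
    · rintro x rfl; exact f0 _ ⟨m0, by simp⟩
    · rintro x rfl; exact f1 _ ⟨m1, by simp⟩
  have hSSne : SS.Nonempty := by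
    refine ⟨_, fun x => 1 - x.1, ?_, ?_, rfl⟩
    · rintro ⟨x, y⟩ ⟨_, hx, _⟩
      simp only [Set.mem_singleton_iff] at hx
      simp [hx]
    · rintro ⟨x, y⟩ ⟨_, hx, _⟩
      simp only [Set.mem_singleton_iff] at hx
      simp [hx]
  have hSPb : BddBelow SP := ⟨0, by rintro e ⟨f, _, _, rfl⟩; exact hD0 f⟩
  have hSSb : BddBelow SS := hSPb.mono hsub
  have hle : sInf SP ≤ sInf SS := csInf_le_csInf hSPb hSSne hsub
  have hcc := cc_pos h m
  -- lower bound for the point conductance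
  have hlow : cc L A m / (16 * K) ≤ sInf SP := by
    apply le_csInf (hSSne.mono hsub)
    rintro e ⟨f, f0, f1, rfl⟩
    have h1 := hcorner m (fun u => f ((u.1 : ℝ) / (L : ℝ) ^ m, (u.2 : ℝ) / (L : ℝ) ^ m))
    have h2 := E_le_D h m f
    have g0 : f (0, 0) = 1 := f0 _ rfl
    have g1 : f (1, 0) = 0 := f1 _ rfl
    simp only [Int.cast_zero, zero_div, Int.cast_pow, Int.cast_natCast, div_self hN.ne', g0, g1]
      at h1
    rw [div_le_iff₀ (by positivity)]
    nlinarith [mul_le_mul_of_nonneg_left h2 hK.le]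
  -- upper bound for the side conductance
  have hup : sInf SS ≤ cc L A m := by
    apply le_csInf (ccSet_ne h m)
    rintro e ⟨F, F0, F1, rfl⟩
    set f : ℝ × ℝ → ℝ := fun x => F (round (x.1 * (L : ℝ) ^ m), round (x.2 * (L : ℝ) ^ m)) with hf
    have hfF : ∀ i j : ℤ, f ((i : ℝ) / (L : ℝ) ^ m, (j : ℝ) / (L : ℝ) ^ m) = F (i, j) := by
      intro i j
      simp only [hf, div_mul_cancel₀ _ hN.ne', round_intCast]
    have h1 := D_le_E h m f
    simp only [hfF] at h1
    refine (csInf_le hSSb ⟨f, ?_, ?_, rfl⟩).trans h1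
    · rintro x ⟨hx, hx0, _⟩
      obtain ⟨i, j, hb, rfl⟩ := VN_coord h m x hx
      rw [hfF]
      simp only [Set.mem_singleton_iff, div_eq_zero_iff, hN.ne', or_false, Int.cast_eq_zero] at hx0
      rw [hx0]
      exact F0 j hb.2.2.1 hb.2.2.2
    · rintro x ⟨hx, hx0, _⟩
      obtain ⟨i, j, hb, rfl⟩ := VN_coord h m x hx
      rw [hfF]
      simp only [Set.mem_singleton_iff, div_eq_one_iff_eq hN.ne'] at hx0
      have hi : i = (L : ℤ) ^ m := by exact_mod_cast hx0
      rw [hi]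
      exact F1 j hb.2.2.1 hb.2.2.2
  have hSPpos : 0 < sInf SP := lt_of_lt_of_le (by positivity) hlow
  have hSSpos : 0 < sInf SS := hSPpos.trans_le hle
  rw [hRR, hRRb]
  refine ⟨inv_anti₀ hSPpos hle, ?_⟩
  have h5 : sInf SS ≤ (16 * K) * sInf SP := by
    rw [div_le_iff₀ (by positivity)] at hlow
    linarith
  calc (sInf SP)⁻¹ ≤ (16 * K) * (sInf SS)⁻¹ := by
        rw [← div_eq_mul_inv, le_div_iff₀ hSSpos, inv_mul_le_iff₀ hSPpos]
        linarith
    _ ≤ max 1 (16 * K) * (sInf SS)⁻¹ := by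
        gcongr
        exact le_max_right _ _


end Carpet
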